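/- arXiv:0710.0872 — 2 statements merged into one kernel-verified Lean document; each statement's English description precedes it below -/
import Mathlib

section
/- Let b > 0, δ > 0, η > 0 be real constants and let v satisfy 0 ≤ v < (√5 − 1)/2. Let y : [0,1] × [0,∞) → ℝ be a sufficiently smooth (of class C³) solution of the PDE y_tt + 2δ y_t + 2v y_xt = (1 − v² + (3/2) b y_x²) y_xx + 2η y_x y_xx y_xt + η y_x² y_xxt on (0,1) × [0,∞) with boundary conditions y(0,t) = y(1,t) = 0 for all t ≥ 0. Define V(t) = ∫₀¹ [ (1/2) y_t² + (1/2)(1−v²) y_x² + (b/8) y_x⁴ ] dx + δ ∫₀¹ [ y y_t + δ y² + (η/4) y_x⁴ ] dx and K = 1 + δ · max{ (1 + 2δ/π)/(π(1 − v²)), 2η/b }. Then for every t ≥ 0, V(t) ≤ V(0) · exp( −[2δ(1 − v − v²)/(K(1 − v²))] · t ); in particular V(t) tends to zero exponentially as t → ∞. -/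
open Real

/-- Partial derivative with respect to the first (spatial) variable. -/
noncomputable def pdx (y : ℝ → ℝ → ℝ) (x t : ℝ) : ℝ := deriv (fun x' => y x' t) x

/-- Partial derivative with respect to the second (time) variable. -/
noncomputable def pdt (y : ℝ → ℝ → ℝ) (x t : ℝ) : ℝ := deriv (fun t' => y x t') t

lemma hasDerivAt_fderiv_left {f : ℝ → ℝ → ℝ} (hf : Differentiable ℝ (Function.uncurry f))
    (x t : ℝ) :
    HasDerivAt (fun x' => f x' t) (fderiv ℝ (Function.uncurry f) (x, t) (1, 0)) x :=
  (hf (x, t)).hasFDerivAt.comp_hasDerivAt (f := fun x' => (x', t)) x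
    ((hasDerivAt_id x).prodMk (hasDerivAt_const x t))

lemma hasDerivAt_fderiv_right {f : ℝ → ℝ → ℝ} (hf : Differentiable ℝ (Function.uncurry f))
    (x t : ℝ) :
    HasDerivAt (fun t' => f x t') (fderiv ℝ (Function.uncurry f) (x, t) (0, 1)) t :=
  (hf (x, t)).hasFDerivAt.comp_hasDerivAt (f := fun t' => (x, t')) t
    ((hasDerivAt_const t x).prodMk (hasDerivAt_id t))

lemma hasDerivAt_pdx {f : ℝ → ℝ → ℝ} (hf : Differentiable ℝ (Function.uncurry f)) (x t : ℝ) :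
    HasDerivAt (fun x' => f x' t) (pdx f x t) x :=
  (hasDerivAt_fderiv_left hf x t).differentiableAt.hasDerivAt

lemma hasDerivAt_pdt {f : ℝ → ℝ → ℝ} (hf : Differentiable ℝ (Function.uncurry f)) (x t : ℝ) :
    HasDerivAt (fun t' => f x t') (pdt f x t) t :=
  (hasDerivAt_fderiv_right hf x t).differentiableAt.hasDerivAt

lemma uncurry_pdx {f : ℝ → ℝ → ℝ} (hf : Differentiable ℝ (Function.uncurry f)) :
    Function.uncurry (pdx f) = fun z => fderiv ℝ (Function.uncurry f) z (1, 0) :=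
  funext fun ⟨x, t⟩ => (hasDerivAt_fderiv_left hf x t).deriv

lemma uncurry_pdt {f : ℝ → ℝ → ℝ} (hf : Differentiable ℝ (Function.uncurry f)) :
    Function.uncurry (pdt f) = fun z => fderiv ℝ (Function.uncurry f) z (0, 1) :=
  funext fun ⟨x, t⟩ => (hasDerivAt_fderiv_right hf x t).deriv

lemma contDiff_pdx {f : ℝ → ℝ → ℝ} {m n : WithTop ℕ∞} (hf : ContDiff ℝ n (Function.uncurry f))
    (hmn : m + 1 ≤ n) : ContDiff ℝ m (Function.uncurry (pdx f)) := by
  rw [uncurry_pdx (hf.differentiable (by rintro rfl; simp at hmn))]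
  exact (hf.fderiv_right hmn).clm_apply contDiff_const

lemma contDiff_pdt {f : ℝ → ℝ → ℝ} {m n : WithTop ℕ∞} (hf : ContDiff ℝ n (Function.uncurry f))
    (hmn : m + 1 ≤ n) : ContDiff ℝ m (Function.uncurry (pdt f)) := by
  rw [uncurry_pdt (hf.differentiable (by rintro rfl; simp at hmn))]
  exact (hf.fderiv_right hmn).clm_apply contDiff_const

lemma pdt_pdx_comm {f : ℝ → ℝ → ℝ} (hf : ContDiff ℝ 2 (Function.uncurry f)) :
    pdt (pdx f) = pdx (pdt f) := by
  have hd : Differentiable ℝ (Function.uncurry f) := hf.differentiable two_ne_zero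
  have h1 : Differentiable ℝ (fderiv ℝ (Function.uncurry f)) :=
    (hf.fderiv_right (m := 1) (by norm_num)).differentiable one_ne_zero
  have hx : Differentiable ℝ (Function.uncurry (pdx f)) :=
    (contDiff_pdx (m := 1) hf (by norm_num)).differentiable one_ne_zero
  have ht : Differentiable ℝ (Function.uncurry (pdt f)) :=
    (contDiff_pdt (m := 1) hf (by norm_num)).differentiable one_ne_zero
  funext x t
  have e1 := (hasDerivAt_fderiv_right hx x t).deriv
  have e2 := (hasDerivAt_fderiv_left ht x t).deriv
  rw [uncurry_pdx hd, fderiv_clm_apply (h1 _) (by fun_prop)] at e1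
  rw [uncurry_pdt hd, fderiv_clm_apply (h1 _) (by fun_prop)] at e2
  have hs := (hf.contDiffAt (x := (x, t))).isSymmSndFDerivAt (by simp) (0, 1) (1, 0)
  simp only [fderiv_fun_const, Pi.zero_apply, ContinuousLinearMap.comp_zero, zero_add,
    ContinuousLinearMap.flip_apply] at e1 e2
  exact (e1.trans hs).trans e2.symm

lemma continuous_slice {f : ℝ → ℝ → ℝ} (hf : Continuous (Function.uncurry f)) (t : ℝ) :
    Continuous fun x => f x t :=
  hf.comp (by fun_prop : Continuous fun x : ℝ => (x, t))

/-- Differentiation under the integral sign for `C¹` integrands on a compact interval. -/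
lemma hasDerivAt_integral_of_contDiff {g : ℝ → ℝ → ℝ} (hg : ContDiff ℝ 1 (Function.uncurry g))
    (a b t : ℝ) :
    HasDerivAt (fun s => ∫ x in a..b, g x s) (∫ x in a..b, pdt g x t) t := by
  have hg' : Continuous (Function.uncurry (pdt g)) :=
    (contDiff_pdt (m := 0) hg (by norm_num)).continuous
  obtain ⟨C, hC⟩ := (isCompact_uIcc (a := a) (b := b)).prod (isCompact_closedBall t 1)
    |>.exists_bound_of_continuousOn hg'.continuousOn
  refine (intervalIntegral.hasDerivAt_integral_of_dominated_loc_of_deriv_le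
    (F := fun s x => g x s) (F' := fun s x => pdt g x s) (bound := fun _ => C)
    (Metric.closedBall_mem_nhds t one_pos) ?_ ?_ ?_ ?_ ?_ ?_).2
  · exact .of_forall fun s => (continuous_slice hg.continuous s).aestronglyMeasurable
  · exact (continuous_slice hg.continuous t).intervalIntegrable _ _
  · exact (continuous_slice hg' t).aestronglyMeasurable
  · exact .of_forall fun x hx s hs => hC (x, s) ⟨Set.uIoc_subset_uIcc hx, hs⟩
  · exact intervalIntegrable_const
  · exact .of_forall fun x _ s _ => hasDerivAt_pdt (hg.differentiable one_ne_zero) x s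

lemma sq_mul_integral_sq_le_of_lt_pi {f f' : ℝ → ℝ} (hf : ∀ x, HasDerivAt f (f' x) x)
    (hf' : Continuous f') (h0 : f 0 = 0) (h1 : f 1 = 0) {l : ℝ} (hl0 : 0 ≤ l) (hl : l < π) :
    l ^ 2 * ∫ x in (0 : ℝ)..1, f x ^ 2 ≤ ∫ x in (0 : ℝ)..1, f' x ^ 2 := by
  have hfc : Continuous f := continuous_iff_continuousAt.2 fun x => (hf x).continuousAt
  have hcos : ∀ x ∈ Set.Icc (0 : ℝ) 1, 0 < cos (l * (x - 1 / 2)) := fun x hx =>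
    cos_pos_of_mem_Ioo ⟨by nlinarith [hx.1, hx.2], by nlinarith [hx.1, hx.2]⟩
  have hder : ∀ x ∈ Set.Icc (0 : ℝ) 1,
      HasDerivAt (fun x => -(l * tan (l * (x - 1 / 2))) * f x ^ 2)
        (-(l ^ 2 * (1 + tan (l * (x - 1 / 2)) ^ 2)) * f x ^ 2
          - l * tan (l * (x - 1 / 2)) * (2 * f x * f' x)) x := by
    intro x hx
    have hc := (hcos x hx).ne'
    have hin : HasDerivAt (fun x : ℝ => l * (x - 1 / 2)) l x := by
      exact (((hasDerivAt_id x).sub_const (1 / 2)).const_mul l).congr_deriv (mul_one l)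
    have ht := (((hasDerivAt_tan hc).comp x hin).const_mul l).neg.mul ((hf x).pow 2)
    refine ht.congr_deriv ?_
    rw [← inv_one_add_tan_sq hc]
    simp
    ring
  have key := intervalIntegral.sub_le_integral_of_hasDeriv_right_of_le zero_le_one
    (fun x hx => (hder x hx).continuousAt.continuousWithinAt)
    (fun x hx => (hder x (Set.Ioo_subset_Icc_self hx)).hasDerivWithinAt)
    (φ := fun x => f' x ^ 2 - l ^ 2 * f x ^ 2)
    (Continuous.integrableOn_Icc (by fun_prop))
    (fun x _ => by nlinarith [sq_nonneg (f' x + l * tan (l * (x - 1 / 2)) * f x)])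
  rw [intervalIntegral.integral_sub (Continuous.intervalIntegrable (by fun_prop) _ _)
    (Continuous.intervalIntegrable (by fun_prop) _ _), intervalIntegral.integral_const_mul] at key
  simp only [h0, h1] at key
  linarith

/-- Wirtinger's inequality with the sharp constant on `[0, 1]`. -/
lemma pi_sq_mul_integral_sq_le {f f' : ℝ → ℝ} (hf : ∀ x, HasDerivAt f (f' x) x)
    (hf' : Continuous f') (h0 : f 0 = 0) (h1 : f 1 = 0) :
    π ^ 2 * ∫ x in (0 : ℝ)..1, f x ^ 2 ≤ ∫ x in (0 : ℝ)..1, f' x ^ 2 := by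
  have hlim : Filter.Tendsto (fun l : ℝ => l ^ 2 * ∫ x in (0 : ℝ)..1, f x ^ 2)
      (nhdsWithin π (Set.Iio π)) (nhds (π ^ 2 * ∫ x in (0 : ℝ)..1, f x ^ 2)) :=
    (Continuous.tendsto (by fun_prop) π).mono_left nhdsWithin_le_nhds
  refine le_of_tendsto hlim ?_
  filter_upwards [Ioo_mem_nhdsLT pi_pos] with l hl
  exact sq_mul_integral_sq_le_of_lt_pi hf hf' h0 h1 hl.1.le hl.2

lemma le_mul_exp_of_deriv_le {V V' : ℝ → ℝ} {c : ℝ} (hV : ∀ t, HasDerivAt V (V' t) t)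
    (h : ∀ t, 0 < t → V' t ≤ -c * V t) {t : ℝ} (ht : 0 ≤ t) : V t ≤ V 0 * exp (-c * t) := by
  have hd : ∀ s, HasDerivAt (fun s => V s * exp (c * s))
      (V' s * exp (c * s) + V s * (exp (c * s) * c)) s := fun s => by
    exact ((hV s).mul ((hasDerivAt_id s).const_mul c).exp).congr_deriv (by simp)
  have hanti : AntitoneOn (fun s => V s * exp (c * s)) (Set.Ici 0) := by
    refine antitoneOn_of_hasDerivWithinAt_nonpos (convex_Ici 0)
      (fun s _ => (hd s).continuousAt.continuousWithinAt)
      (fun s _ => (hd s).hasDerivWithinAt) fun s hs => ?_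
    rw [interior_Ici] at hs
    nlinarith [h s hs, exp_pos (c * s)]
  have h0 : V t * exp (c * t) ≤ V 0 * exp (c * 0) := hanti Set.self_mem_Ici ht ht
  rw [mul_zero, exp_zero, mul_one] at h0
  rwa [neg_mul, exp_neg, ← div_eq_mul_inv, le_div_iff₀ (exp_pos _)]

lemma velocity_bound {v : ℝ} (hv0 : 0 ≤ v) (hv1 : v < (Real.sqrt 5 - 1) / 2) :
    0 < 1 - v - v ^ 2 := by
  have h5 : Real.sqrt 5 ^ 2 = 5 := sq_sqrt (by norm_num)
  nlinarith [sqrt_nonneg 5]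

/-- Pointwise dissipation bound: `c` is the decay rate of the energy density. -/
lemma dissipation_le {b δ η v c p q r : ℝ} (hb : 0 < b) (hδ : 0 < δ) (hη : 0 < η) (hv0 : 0 ≤ v)
    (hv : 0 < 1 - v - v ^ 2) (hc : c * (1 - v ^ 2) = 1 - v - v ^ 2) :
    -(η * p ^ 2 * r ^ 2) - δ * ((1 - v ^ 2) * p ^ 2 + b / 2 * p ^ 4) + 2 * v * δ * p * q
        - δ * q ^ 2
      ≤ -(2 * δ * c) * ((1/2) * q ^ 2 + (1/2) * (1 - v ^ 2) * p ^ 2 + (b/8) * p ^ 4) := by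
  have hv2 : 0 < 1 - v ^ 2 := by linarith
  have hc1 : c ≤ 1 := by
    by_contra! h
    nlinarith
  have hcv : c ≤ 1 - v := by
    by_contra! h
    nlinarith [pow_nonneg hv0 3]
  have h1 : 0 ≤ η * p ^ 2 * r ^ 2 := by positivity
  have h2 : 0 ≤ δ * v * (p - q) ^ 2 := by positivity
  have h3 : 0 ≤ δ * (1 - v - c) * q ^ 2 :=
    mul_nonneg (mul_nonneg hδ.le (by linarith)) (sq_nonneg q)
  have h4 : 0 ≤ δ * b * p ^ 4 * (2 - c) := mul_nonneg (by positivity) (by linarith)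
  have h5 : δ * p ^ 2 * (c * (1 - v ^ 2)) = δ * p ^ 2 * (1 - v - v ^ 2) := by rw [hc]
  linarith

/-- Pointwise bound of the perturbation density by the energy density, up to a term that
integrates to something nonpositive by Wirtinger's inequality. -/
lemma perturbation_le {b δ η v M u p q : ℝ} (hb : 0 < b) (hδ : 0 < δ) (hv2 : 0 < 1 - v ^ 2)
    (hM1 : (1 + 2 * δ / π) / (π * (1 - v ^ 2)) ≤ M) (hM2 : 2 * η / b ≤ M) :
    u * q + δ * u ^ 2 + (η/4) * p ^ 4
      ≤ (1 / (2 * π) + δ / π ^ 2) * (π ^ 2 * u ^ 2 - p ^ 2)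
        + M * ((1/2) * q ^ 2 + (1/2) * (1 - v ^ 2) * p ^ 2 + (b/8) * p ^ 4) := by
  have hπ := pi_pos
  have h1 : 1 / π + 2 * (δ / π ^ 2) ≤ M * (1 - v ^ 2) := by
    rw [div_le_iff₀ (by positivity)] at hM1
    have : 1 / π + 2 * (δ / π ^ 2) = (1 + 2 * δ / π) / π := by field_simp
    rw [this, div_le_iff₀ hπ]
    linarith
  have hM : 0 ≤ M := le_trans (by positivity) hM1
  have h2 : 1 / π ≤ M := by
    have : 0 ≤ δ / π ^ 2 := by positivity
    nlinarith [sq_nonneg v]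
  have h3 : 2 * η ≤ M * b := (div_le_iff₀ hb).1 hM2
  have h4 : 0 ≤ 1 / (2 * π) * (π * u - q) ^ 2 := by positivity
  have h5 : 1 / (2 * π) * (π * u - q) ^ 2
      = 1 / (2 * π) * π ^ 2 * u ^ 2 - u * q + (1 / π) * q ^ 2 / 2 := by
    field_simp
    ring
  have h6 : δ / π ^ 2 * π ^ 2 = δ := by field_simp
  have h7 : 1 / (2 * π) = (1 / π) / 2 := by field_simp
  have e1 := mul_le_mul_of_nonneg_right h1 (sq_nonneg p)
  have e2 := mul_le_mul_of_nonneg_right h2 (sq_nonneg q)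
  have e3 := mul_le_mul_of_nonneg_right h3 (by positivity : 0 ≤ p ^ 4)
  have e6 : δ / π ^ 2 * π ^ 2 * u ^ 2 = δ * u ^ 2 := by rw [h6]
  rw [h7] at h4 h5 ⊢
  generalize 1 / π = s at *
  generalize δ / π ^ 2 = d at *
  linarith

/-- Along C³ solutions of the Kelvin–Voigt moving-string PDE with subcritical
speed `v < (√5 − 1)/2`, the Lyapunov function `V` decays exponentially:
`V(t) ≤ V(0) exp(−[2δ(1 − v − v²)/(K(1 − v²))] t)`. -/
theorem stmt_14 (b δ η v : ℝ) (hb : 0 < b) (hδ : 0 < δ) (hη : 0 < η)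
    (hv0 : 0 ≤ v) (hv1 : v < (Real.sqrt 5 - 1) / 2)
    (y : ℝ → ℝ → ℝ)
    (hy : ContDiff ℝ 3 (Function.uncurry y))
    (hpde : ∀ x ∈ Set.Ioo (0:ℝ) 1, ∀ t : ℝ, 0 ≤ t →
      pdt (pdt y) x t + 2 * δ * pdt y x t + 2 * v * pdx (pdt y) x t
        = (1 - v ^ 2 + (3/2) * b * (pdx y x t) ^ 2) * pdx (pdx y) x t
          + 2 * η * pdx y x t * pdx (pdx y) x t * pdx (pdt y) x t
          + η * (pdx y x t) ^ 2 * pdx (pdx (pdt y)) x t)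
    (hbc : ∀ t : ℝ, 0 ≤ t → y 0 t = 0 ∧ y 1 t = 0)
    (V : ℝ → ℝ)
    (hV : ∀ t : ℝ, V t =
      (∫ x in (0:ℝ)..1,
        ((1/2) * (pdt y x t) ^ 2 + (1/2) * (1 - v ^ 2) * (pdx y x t) ^ 2
          + (b/8) * (pdx y x t) ^ 4))
      + δ * ∫ x in (0:ℝ)..1,
        (y x t * pdt y x t + δ * (y x t) ^ 2 + (η/4) * (pdx y x t) ^ 4))
    (K : ℝ)
    (hK : K = 1 + δ * max ((1 + 2 * δ / π) / (π * (1 - v ^ 2))) (2 * η / b)) :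
    ∀ t : ℝ, 0 ≤ t →
      V t ≤ V 0 * Real.exp (-(2 * δ * (1 - v - v ^ 2) / (K * (1 - v ^ 2))) * t) := by
  have hv := velocity_bound hv0 hv1
  have hv2 : 0 < 1 - v ^ 2 := by linarith
  have hq2 : ContDiff ℝ 2 (Function.uncurry (pdt y)) := contDiff_pdt hy (by norm_num)
  have hp2 : ContDiff ℝ 2 (Function.uncurry (pdx y)) := contDiff_pdx hy (by norm_num)
  have hr1 : ContDiff ℝ 1 (Function.uncurry (pdx (pdt y))) := contDiff_pdx hq2 (by norm_num)
  have hxx1 : ContDiff ℝ 1 (Function.uncurry (pdx (pdx y))) := contDiff_pdx hp2 (by norm_num)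
  have hxxt0 : ContDiff ℝ 0 (Function.uncurry (pdx (pdx (pdt y)))) :=
    contDiff_pdx hr1 (by norm_num)
  have htt1 : ContDiff ℝ 1 (Function.uncurry (pdt (pdt y))) := contDiff_pdt hq2 (by norm_num)
  have hcomm : pdt (pdx y) = pdx (pdt y) := pdt_pdx_comm (hy.of_le (by norm_num))
  have hyd := hy.differentiable (by norm_num)
  have hqd := hq2.differentiable (by norm_num)
  have hpd := hp2.differentiable (by norm_num)
  have hrd := hr1.differentiable (by norm_num)
  have cy := fun t => continuous_slice hy.continuous t
  have cq := fun t => continuous_slice hq2.continuous t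
  have cp := fun t => continuous_slice hp2.continuous t
  have cr := fun t => continuous_slice hr1.continuous t
  have cxx := fun t => continuous_slice hxx1.continuous t
  have cxxt := fun t => continuous_slice hxxt0.continuous t
  have ctt := fun t => continuous_slice htt1.continuous t
  set e : ℝ → ℝ → ℝ := fun x t => (1/2) * (pdt y x t) ^ 2
    + (1/2) * (1 - v ^ 2) * (pdx y x t) ^ 2 + (b/8) * (pdx y x t) ^ 4 with he
  set w : ℝ → ℝ → ℝ := fun x t => y x t * pdt y x t + δ * (y x t) ^ 2
    + (η/4) * (pdx y x t) ^ 4 with hw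
  have ce : ∀ t, Continuous fun x => e x t := fun t => by
    have := cq t; have := cp t; simp only [he]; fun_prop
  have cw : ∀ t, Continuous fun x => w x t := fun t => by
    have := cy t; have := cq t; have := cp t; simp only [hw]; fun_prop
  set g : ℝ → ℝ → ℝ := fun x t => e x t + δ * w x t
  have hg1 : ContDiff ℝ 1 (Function.uncurry g) := by
    have h1 : ContDiff ℝ 1 (Function.uncurry y) := hy.of_le (by norm_num)
    have h2 : ContDiff ℝ 1 (Function.uncurry (pdt y)) := hq2.of_le (by norm_num)
    have h3 : ContDiff ℝ 1 (Function.uncurry (pdx y)) := hp2.of_le (by norm_num)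
    exact (((contDiff_const.mul (h2.pow 2)).add (contDiff_const.mul (h3.pow 2))).add
      (contDiff_const.mul (h3.pow 4))).add (contDiff_const.mul
        (((h1.mul h2).add (contDiff_const.mul (h1.pow 2))).add (contDiff_const.mul (h3.pow 4))))
  have hgV : ∀ t, V t = ∫ x in (0:ℝ)..1, g x t := fun t => by
    rw [hV t, ← intervalIntegral.integral_const_mul, ← intervalIntegral.integral_add
      ((ce t).intervalIntegrable _ _) (((cw t).const_mul δ).intervalIntegrable _ _)]
  have hVd : ∀ t, HasDerivAt V (∫ x in (0:ℝ)..1, pdt g x t) t := fun t => by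
    rw [funext hgV]
    exact hasDerivAt_integral_of_contDiff hg1 0 1 t
  set E : ℝ → ℝ := fun t => ∫ x in (0:ℝ)..1, e x t
  have hgt : ∀ x t, pdt g x t = pdt y x t * pdt (pdt y) x t
      + (1 - v ^ 2) * pdx y x t * pdx (pdt y) x t + b / 2 * pdx y x t ^ 3 * pdx (pdt y) x t
      + δ * (pdt y x t ^ 2 + y x t * pdt (pdt y) x t + 2 * δ * y x t * pdt y x t
        + η * pdx y x t ^ 3 * pdx (pdt y) x t) := fun x t => by
    have d1 := hasDerivAt_pdt hyd x t
    have d2 := hasDerivAt_pdt hqd x t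
    have d3 := hasDerivAt_pdt hpd x t
    rw [hcomm] at d3
    refine (((((d2.pow 2).const_mul (1/2)).add ((d3.pow 2).const_mul ((1/2) * (1 - v ^ 2)))).add
      ((d3.pow 4).const_mul (b/8))).add ((((d1.mul d2).add ((d1.pow 2).const_mul δ)).add
        ((d3.pow 4).const_mul (η/4))).const_mul δ)).deriv.trans ?_
    simp
    ring
  obtain ⟨c, hc⟩ : ∃ c, c = (1 - v - v ^ 2) / (1 - v ^ 2) := ⟨_, rfl⟩
  have hc0 : 0 < c := hc ▸ div_pos hv hv2
  have hc' : c * (1 - v ^ 2) = 1 - v - v ^ 2 := by rw [hc]; field_simp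
  have hdecay : ∀ t, 0 < t → ∫ x in (0:ℝ)..1, pdt g x t ≤ -(2 * δ * c) * E t := by
    intro t ht
    have hq0 : ∀ a : ℝ, (∀ s, 0 ≤ s → y a s = 0) → pdt y a t = 0 := fun a ha => by
      have : (fun s => y a s) =ᶠ[nhds t] fun _ => (0 : ℝ) := by
        filter_upwards [lt_mem_nhds ht] with s hs using ha s hs.le
      exact this.deriv_eq.trans (deriv_const _ _)
    have hq00 := hq0 0 fun s hs => (hbc s hs).1
    have hq01 := hq0 1 fun s hs => (hbc s hs).2
    set S : ℝ → ℝ := fun x => (1 - v ^ 2) * pdx y x t + b / 2 * pdx y x t ^ 3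
      + η * pdx y x t ^ 2 * pdx (pdt y) x t with hS
    set S' : ℝ → ℝ := fun x => (1 - v ^ 2 + (3/2) * b * (pdx y x t) ^ 2) * pdx (pdx y) x t
      + 2 * η * pdx y x t * pdx (pdx y) x t * pdx (pdt y) x t
      + η * (pdx y x t) ^ 2 * pdx (pdx (pdt y)) x t with hS'
    set P' : ℝ → ℝ := fun x => (pdx (pdt y) x t + δ * pdx y x t) * S x
      + (pdt y x t + δ * y x t) * S' x - 2 * v * pdt y x t * pdx (pdt y) x t
      - 2 * v * δ * (pdx y x t * pdt y x t + y x t * pdx (pdt y) x t) with hP'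
    have := cy t
    have := cq t
    have := cp t
    have := cr t
    have := cxx t
    have := cxxt t
    have := ctt t
    have cS : Continuous S := by simp only [hS]; fun_prop
    have cS' : Continuous S' := by simp only [hS']; fun_prop
    have cP' : Continuous P' := by simp only [hP']; fun_prop
    have hPd : ∀ x, HasDerivAt (fun x => (pdt y x t + δ * y x t) * S x - v * pdt y x t ^ 2
        - 2 * v * δ * (y x t * pdt y x t)) (P' x) x := fun x => by
      have d1 := hasDerivAt_pdx hyd x t
      have d2 := hasDerivAt_pdx hqd x t
      have d3 := hasDerivAt_pdx hpd x t
      have d4 := hasDerivAt_pdx hrd x t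
      have dS : HasDerivAt S (S' x) x := by
        refine (((d3.const_mul (1 - v ^ 2)).add ((d3.pow 3).const_mul (b / 2))).add
          (((d3.pow 2).const_mul η).mul d4)).congr_deriv ?_
        simp [hS']
        ring
      refine ((((d2.add (d1.const_mul δ)).mul dS).sub ((d2.pow 2).const_mul v)).sub
        ((d1.mul d2).const_mul (2 * v * δ))).congr_deriv ?_
      simp [hP']
      ring
    have hP0 : ∫ x in (0:ℝ)..1, P' x = 0 := by
      rw [intervalIntegral.integral_eq_sub_of_hasDerivAt (fun x _ => hPd x)
        (cP'.intervalIntegrable _ _)]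
      simp [hq00, hq01, (hbc t ht.le).1, (hbc t ht.le).2]
    have hmono : ∫ x in (0:ℝ)..1, pdt g x t
        ≤ ∫ x in (0:ℝ)..1, (P' x + -(2 * δ * c) * e x t) := by
      refine intervalIntegral.integral_mono_on_of_le_Ioo zero_le_one
        (Continuous.intervalIntegrable (by simp only [hgt]; fun_prop) _ _)
        ((cP'.add ((ce t).const_mul _)).intervalIntegrable _ _) fun x hx => ?_
      have hD := dissipation_le (p := pdx y x t) (q := pdt y x t) (r := pdx (pdt y) x t)
        hb hδ hη hv0 hv hc'
      have hP : pdt (pdt y) x t = S' x - 2 * δ * pdt y x t - 2 * v * pdx (pdt y) x t := by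
        have h : pdt (pdt y) x t + 2 * δ * pdt y x t + 2 * v * pdx (pdt y) x t = S' x :=
          hpde x hx t ht.le
        linarith
      rw [hgt, hP]
      refine le_trans (le_of_eq ?_) (add_le_add_right hD (P' x))
      simp only [hP', hS]
      ring
    rwa [intervalIntegral.integral_add (cP'.intervalIntegrable _ _)
      (((ce t).const_mul _).intervalIntegrable _ _), hP0, zero_add,
      intervalIntegral.integral_const_mul] at hmono
  obtain ⟨M, hM⟩ : ∃ M, M = max ((1 + 2 * δ / π) / (π * (1 - v ^ 2))) (2 * η / b) := ⟨_, rfl⟩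
  have hM1 : (1 + 2 * δ / π) / (π * (1 - v ^ 2)) ≤ M := hM ▸ le_max_left _ _
  have hM2 : 2 * η / b ≤ M := hM ▸ le_max_right _ _
  have hK1 : 0 < K := by
    have : 0 ≤ M := le_trans (by positivity) hM2
    rw [hK, ← hM]
    positivity
  have hVE : ∀ t, 0 ≤ t → V t ≤ K * E t := by
    intro t ht
    have hW := pi_sq_mul_integral_sq_le (fun x => hasDerivAt_pdx hyd x t) (cp t)
      (hbc t ht).1 (hbc t ht).2
    have := cy t
    have := cp t
    have i1 : IntervalIntegrable (fun x => π ^ 2 * y x t ^ 2) MeasureTheory.volume 0 1 :=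
      Continuous.intervalIntegrable (by fun_prop) _ _
    have i2 : IntervalIntegrable (fun x => pdx y x t ^ 2) MeasureTheory.volume 0 1 :=
      Continuous.intervalIntegrable (by fun_prop) _ _
    have hle : ∫ x in (0:ℝ)..1, w x t ≤ ∫ x in (0:ℝ)..1,
        ((1 / (2 * π) + δ / π ^ 2) * (π ^ 2 * y x t ^ 2 - pdx y x t ^ 2) + M * e x t) :=
      intervalIntegral.integral_mono_on zero_le_one ((cw t).intervalIntegrable _ _)
        (((i1.sub i2).const_mul _).add (((ce t).intervalIntegrable _ _).const_mul _))
        fun x _ => perturbation_le hb hδ hv2 hM1 hM2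
    rw [intervalIntegral.integral_add ((i1.sub i2).const_mul _)
      (((ce t).intervalIntegrable _ _).const_mul _), intervalIntegral.integral_const_mul,
      intervalIntegral.integral_const_mul, intervalIntegral.integral_sub i1 i2,
      intervalIntegral.integral_const_mul] at hle
    have hneg := mul_nonneg (by positivity : 0 ≤ 1 / (2 * π) + δ / π ^ 2) (sub_nonneg.2 hW)
    have hw' : ∫ x in (0:ℝ)..1, w x t ≤ M * E t := by linarith
    have hVt : V t = E t + δ * ∫ x in (0:ℝ)..1, w x t := hV t
    rw [hVt, hK, ← hM]
    linarith [mul_le_mul_of_nonneg_left hw' hδ.le]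
  intro t ht
  have hrate : 2 * δ * (1 - v - v ^ 2) / (K * (1 - v ^ 2)) = 2 * δ * c / K := by
    rw [← hc']
    field_simp
  rw [hrate]
  refine le_mul_exp_of_deriv_le hVd (fun s hs => (hdecay s hs).trans ?_) ht
  rw [neg_mul, neg_mul, neg_le_neg_iff, div_mul_eq_mul_div, div_le_iff₀ hK1]
  linarith [mul_le_mul_of_nonneg_left (hVE s hs.le) (by positivity : 0 ≤ 2 * δ * c)]
end

section
/- Let b > 0 and η > 0 be real constants and let v satisfy 0 ≤ v < 1. Let y : [0,1] × [0,∞) → ℝ be a sufficiently smooth (of class C³) solution of the undamped-in-viscosity PDE y_tt + 2v y_xt = (1 − v² + (3/2) b y_x²) y_xx + 2η y_x y_xx y_xt + η y_x² y_xxt on (0,1) × [0,∞) with boundary conditions y(0,t) = y(1,t) = 0 for all t ≥ 0. Define E(t) = ∫₀¹ [ (1/2) y_t² + (1/2)(1−v²) y_x² + (b/8) y_x⁴ ] dx. Then t ↦ E(t) is differentiable on [0,∞) with E′(t) = −η ∫₀¹ y_x(x,t)² y_xt(x,t)² dx ≤ 0 for every t ≥ 0; in particular, E is nonincreasing. -/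
open Real

theorem hasDerivAt_fst_of_contDiff {y : ℝ → ℝ → ℝ} {n : WithTop ℕ∞} (hn : n ≠ 0)
    (hy : ContDiff ℝ n (Function.uncurry y)) (x t : ℝ) :
    HasDerivAt (fun x' => y x' t) (fderiv ℝ (Function.uncurry y) (x, t) (1, 0)) x := by
  have h := (hy.differentiable hn (x, t)).hasFDerivAt
  exact h.comp_hasDerivAt x (f := fun x' : ℝ => (x', t))
    ((hasDerivAt_id x).prodMk (hasDerivAt_const x t))

theorem hasDerivAt_snd_of_contDiff {y : ℝ → ℝ → ℝ} {n : WithTop ℕ∞} (hn : n ≠ 0)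
    (hy : ContDiff ℝ n (Function.uncurry y)) (x t : ℝ) :
    HasDerivAt (fun t' => y x t') (fderiv ℝ (Function.uncurry y) (x, t) (0, 1)) t := by
  have h := (hy.differentiable hn (x, t)).hasFDerivAt
  exact h.comp_hasDerivAt t (f := fun t' : ℝ => (x, t'))
    ((hasDerivAt_const t x).prodMk (hasDerivAt_id t))

theorem uncurry_pdx_s17 {y : ℝ → ℝ → ℝ} {n : WithTop ℕ∞} (hn : n ≠ 0)
    (hy : ContDiff ℝ n (Function.uncurry y)) :
    Function.uncurry (pdx y) = fun p => fderiv ℝ (Function.uncurry y) p (1, 0) := by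
  funext ⟨x, t⟩
  exact (hasDerivAt_fst_of_contDiff hn hy x t).deriv

theorem uncurry_pdt_s17 {y : ℝ → ℝ → ℝ} {n : WithTop ℕ∞} (hn : n ≠ 0)
    (hy : ContDiff ℝ n (Function.uncurry y)) :
    Function.uncurry (pdt y) = fun p => fderiv ℝ (Function.uncurry y) p (0, 1) := by
  funext ⟨x, t⟩
  exact (hasDerivAt_snd_of_contDiff hn hy x t).deriv

theorem ContDiff.hasDerivAt_pdx {y : ℝ → ℝ → ℝ} {n : WithTop ℕ∞}
    (hy : ContDiff ℝ n (Function.uncurry y)) (hn : n ≠ 0) (x t : ℝ) :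
    HasDerivAt (fun x' => y x' t) (pdx y x t) x :=
  (hasDerivAt_fst_of_contDiff hn hy x t).differentiableAt.hasDerivAt

theorem ContDiff.hasDerivAt_pdt {y : ℝ → ℝ → ℝ} {n : WithTop ℕ∞}
    (hy : ContDiff ℝ n (Function.uncurry y)) (hn : n ≠ 0) (x t : ℝ) :
    HasDerivAt (fun t' => y x t') (pdt y x t) t :=
  (hasDerivAt_snd_of_contDiff hn hy x t).differentiableAt.hasDerivAt

theorem ContDiff.uncurry_pdx {y : ℝ → ℝ → ℝ} {m n : WithTop ℕ∞}
    (hy : ContDiff ℝ n (Function.uncurry y)) (hmn : m + 1 ≤ n) :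
    ContDiff ℝ m (Function.uncurry (pdx y)) := by
  rw [_root_.uncurry_pdx_s17 (by rintro rfl; simp at hmn) hy]
  exact (hy.fderiv_right hmn).clm_apply contDiff_const

theorem ContDiff.uncurry_pdt {y : ℝ → ℝ → ℝ} {m n : WithTop ℕ∞}
    (hy : ContDiff ℝ n (Function.uncurry y)) (hmn : m + 1 ≤ n) :
    ContDiff ℝ m (Function.uncurry (pdt y)) := by
  rw [_root_.uncurry_pdt_s17 (by rintro rfl; simp at hmn) hy]
  exact (hy.fderiv_right hmn).clm_apply contDiff_const

theorem pdt_pdx_comm_s17 {y : ℝ → ℝ → ℝ} (hy : ContDiff ℝ 2 (Function.uncurry y)) (x t : ℝ) :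
    pdt (pdx y) x t = pdx (pdt y) x t := by
  have hx : ContDiff ℝ 1 (Function.uncurry (pdx y)) := hy.uncurry_pdx (by norm_num)
  have ht : ContDiff ℝ 1 (Function.uncurry (pdt y)) := hy.uncurry_pdt (by norm_num)
  have hd : DifferentiableAt ℝ (fderiv ℝ (Function.uncurry y)) (x, t) :=
    (hy.fderiv_right (m := 1) (by norm_num)).differentiable (by norm_num) _
  have h1 := (hasDerivAt_snd_of_contDiff one_ne_zero hx x t).deriv
  have h2 := (hasDerivAt_fst_of_contDiff one_ne_zero ht x t).deriv
  have hs : IsSymmSndFDerivAt ℝ (Function.uncurry y) (x, t) :=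
    hy.contDiffAt.isSymmSndFDerivAt (by simp)
  rw [uncurry_pdx_s17 two_ne_zero hy, fderiv_clm_apply hd (by fun_prop)] at h1
  rw [uncurry_pdt_s17 two_ne_zero hy, fderiv_clm_apply hd (by fun_prop)] at h2
  rw [pdt, pdx, h1, h2]
  simpa using hs.eq (0, 1) (1, 0)

/-- Differentiation under the integral sign for a jointly continuous partial derivative. -/
theorem hasDerivAt_intervalIntegral_of_continuous {f f' : ℝ → ℝ → ℝ} {a b : ℝ}
    (hf : Continuous (Function.uncurry f)) (hf' : Continuous (Function.uncurry f'))
    (h : ∀ x t, HasDerivAt (fun t' => f x t') (f' x t) t) (t : ℝ) :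
    HasDerivAt (fun s => ∫ x in a..b, f x s) (∫ x in a..b, f' x t) t := by
  have hc : IsCompact (Set.uIcc a b ×ˢ Metric.closedBall t 1) :=
    isCompact_uIcc.prod (isCompact_closedBall t 1)
  obtain ⟨C, hC⟩ := hc.exists_bound_of_continuousOn hf'.continuousOn
  have hfs : ∀ s, Continuous fun x => f x s := fun s => hf.comp (by fun_prop : Continuous fun x => (x, s))
  have hfs' : ∀ s, Continuous fun x => f' x s := fun s => hf'.comp (by fun_prop : Continuous fun x => (x, s))
  refine (intervalIntegral.hasDerivAt_integral_of_dominated_loc_of_deriv_le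
    (F := fun s x => f x s) (F' := fun s x => f' x s) (bound := fun _ => C)
    (Metric.closedBall_mem_nhds t one_pos)
    (Filter.Eventually.of_forall fun s => (hfs s).aestronglyMeasurable)
    ((hfs t).intervalIntegrable _ _) (hfs' t).aestronglyMeasurable ?_ ?_ ?_).2
  · exact Filter.Eventually.of_forall fun x hx s hs =>
      hC (x, s) ⟨Set.uIoc_subset_uIcc hx, hs⟩
  · exact intervalIntegrable_const
  · exact Filter.Eventually.of_forall fun x _ s _ => h x s

theorem pdt_eq_zero_of_forall_nonneg {y : ℝ → ℝ → ℝ} {n : WithTop ℕ∞}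
    (hy : ContDiff ℝ n (Function.uncurry y)) (hn : n ≠ 0) {x : ℝ}
    (h : ∀ t, 0 ≤ t → y x t = 0) {t : ℝ} (ht : 0 ≤ t) : pdt y x t = 0 := by
  have h1 := (hy.hasDerivAt_pdt hn x t).hasDerivWithinAt (s := Set.Ici 0)
  have h2 : HasDerivWithinAt (fun t' => y x t') 0 (Set.Ici 0) t :=
    (hasDerivWithinAt_const t (Set.Ici 0) (0 : ℝ)).congr (fun s hs => h s hs) (h t ht)
  exact (uniqueDiffOn_Ici 0 t ht).eq_deriv _ h1 h2

/-- For the moving string with only Kelvin–Voigt damping (no viscous damping),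
the energy `E` is differentiable with
`E′(t) = −η ∫₀¹ yₓ² yₓₜ² dx ≤ 0`; in particular `E` is nonincreasing on `[0,∞)`. -/
theorem stmt_17 (b η v : ℝ) (hb : 0 < b) (hη : 0 < η)
    (hv0 : 0 ≤ v) (hv1 : v < 1)
    (y : ℝ → ℝ → ℝ)
    (hy : ContDiff ℝ 3 (Function.uncurry y))
    (hpde : ∀ x ∈ Set.Ioo (0:ℝ) 1, ∀ t : ℝ, 0 ≤ t →
      pdt (pdt y) x t + 2 * v * pdx (pdt y) x t
        = (1 - v ^ 2 + (3/2) * b * (pdx y x t) ^ 2) * pdx (pdx y) x t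
          + 2 * η * pdx y x t * pdx (pdx y) x t * pdx (pdt y) x t
          + η * (pdx y x t) ^ 2 * pdx (pdx (pdt y)) x t)
    (hbc : ∀ t : ℝ, 0 ≤ t → y 0 t = 0 ∧ y 1 t = 0)
    (E : ℝ → ℝ)
    (hE : ∀ t : ℝ, E t = ∫ x in (0:ℝ)..1,
      ((1/2) * (pdt y x t) ^ 2 + (1/2) * (1 - v ^ 2) * (pdx y x t) ^ 2
        + (b/8) * (pdx y x t) ^ 4)) :
    (∀ t : ℝ, 0 ≤ t → DifferentiableAt ℝ E t ∧
      deriv E t = -η * (∫ x in (0:ℝ)..1, (pdx y x t) ^ 2 * (pdx (pdt y) x t) ^ 2)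
      ∧ deriv E t ≤ 0)
    ∧ AntitoneOn E (Set.Ici 0) := by
  have hyx : ContDiff ℝ 2 (Function.uncurry (pdx y)) := hy.uncurry_pdx (by norm_num)
  have hyt : ContDiff ℝ 2 (Function.uncurry (pdt y)) := hy.uncurry_pdt (by norm_num)
  have hytt : ContDiff ℝ 1 (Function.uncurry (pdt (pdt y))) := hyt.uncurry_pdt (by norm_num)
  have hyxt : ContDiff ℝ 1 (Function.uncurry (pdx (pdt y))) := hyt.uncurry_pdx (by norm_num)
  have cx : Continuous fun p : ℝ × ℝ => pdx y p.1 p.2 := hyx.continuous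
  have ct : Continuous fun p : ℝ × ℝ => pdt y p.1 p.2 := hyt.continuous
  have ctt : Continuous fun p : ℝ × ℝ => pdt (pdt y) p.1 p.2 := hytt.continuous
  have cxt : Continuous fun p : ℝ × ℝ => pdx (pdt y) p.1 p.2 := hyxt.continuous
  have hcomm := pdt_pdx_comm_s17 (hy.of_le (by norm_num))
  have hderiv : ∀ t, 0 ≤ t → HasDerivAt E
      (-η * (∫ x in (0:ℝ)..1, (pdx y x t) ^ 2 * (pdx (pdt y) x t) ^ 2)) t := by
    intro t ht
    have hdE : HasDerivAt E (∫ x in (0:ℝ)..1, (pdt y x t * pdt (pdt y) x t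
        + (1 - v ^ 2) * pdx y x t * pdx (pdt y) x t
        + (b / 2) * pdx y x t ^ 3 * pdx (pdt y) x t)) t := by
      rw [funext hE]
      refine hasDerivAt_intervalIntegral_of_continuous
        (f' := fun x t => pdt y x t * pdt (pdt y) x t
          + (1 - v ^ 2) * pdx y x t * pdx (pdt y) x t
          + (b / 2) * pdx y x t ^ 3 * pdx (pdt y) x t) ?_ ?_ ?_ t
      · simp only [Function.uncurry_def]; fun_prop
      · simp only [Function.uncurry_def]; fun_prop
      · intro x s
        have h1 := hyt.hasDerivAt_pdt two_ne_zero x s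
        have h2 := hyx.hasDerivAt_pdt two_ne_zero x s
        rw [hcomm] at h2
        refine ((((h1.pow 2).const_mul (1 / 2)).add
          ((h2.pow 2).const_mul ((1 / 2) * (1 - v ^ 2)))).add
          ((h2.pow 4).const_mul (b / 8))).congr_deriv ?_
        push_cast
        ring
    have hslice : ∀ {g : ℝ → ℝ → ℝ}, (Continuous fun p : ℝ × ℝ => g p.1 p.2) →
        Continuous fun x => g x t :=
      fun hg => hg.comp (by fun_prop : Continuous fun x : ℝ => (x, t))
    have sx := hslice cx
    have st := hslice ct
    have stt := hslice ctt
    have sxt := hslice cxt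
    have hflux : ∫ x in (0:ℝ)..1, ((pdt y x t * pdt (pdt y) x t
        + (1 - v ^ 2) * pdx y x t * pdx (pdt y) x t
        + (b / 2) * pdx y x t ^ 3 * pdx (pdt y) x t)
        + η * ((pdx y x t) ^ 2 * (pdx (pdt y) x t) ^ 2)) = 0 := by
      rw [intervalIntegral.integral_eq_sub_of_hasDerivAt_of_le zero_le_one
        (f := fun x => pdt y x t * ((1 - v ^ 2) * pdx y x t + (b / 2) * pdx y x t ^ 3
          + η * (pdx y x t ^ 2 * pdx (pdt y) x t)) - v * pdt y x t ^ 2)]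
      · have h0 := pdt_eq_zero_of_forall_nonneg hy three_ne_zero (fun s hs => (hbc s hs).1) ht
        have h1 := pdt_eq_zero_of_forall_nonneg hy three_ne_zero (fun s hs => (hbc s hs).2) ht
        simp [h0, h1]
      · fun_prop
      · intro x hx
        have h1 := hyt.hasDerivAt_pdx two_ne_zero x t
        have h2 := hyx.hasDerivAt_pdx two_ne_zero x t
        have h3 := hyxt.hasDerivAt_pdx one_ne_zero x t
        refine ((h1.mul (((h2.const_mul (1 - v ^ 2)).add ((h2.pow 3).const_mul (b / 2))).add
          (((h2.pow 2).mul h3).const_mul η))).sub ((h1.pow 2).const_mul v)).congr_deriv ?_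
        simp only [Pi.add_apply, Pi.mul_apply, Pi.pow_apply]
        push_cast
        linear_combination -pdt y x t * hpde x hx t ht
      · exact Continuous.intervalIntegrable (by fun_prop) _ _
    rw [intervalIntegral.integral_add (Continuous.intervalIntegrable (by fun_prop) _ _)
      (Continuous.intervalIntegrable (by fun_prop) _ _),
      intervalIntegral.integral_const_mul] at hflux
    convert hdE using 1
    linarith
  have hnonpos : ∀ t, -η * (∫ x in (0:ℝ)..1, (pdx y x t) ^ 2 * (pdx (pdt y) x t) ^ 2) ≤ 0 :=
    fun t => mul_nonpos_of_nonpos_of_nonneg (by linarith)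
      (intervalIntegral.integral_nonneg zero_le_one fun x _ => by positivity)
  refine ⟨fun t ht => ⟨(hderiv t ht).differentiableAt, (hderiv t ht).deriv,
    (hderiv t ht).deriv.trans_le (hnonpos t)⟩, ?_⟩
  refine antitoneOn_of_deriv_nonpos (convex_Ici 0)
    (fun t ht => (hderiv t ht).continuousAt.continuousWithinAt)
    (fun t ht => (hderiv t (interior_subset ht)).differentiableAt.differentiableWithinAt)
    fun t ht => (hderiv t (interior_subset ht)).deriv.trans_le (hnonpos t)
end
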